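/- arXiv:math/0009025 — 3 statements merged into one kernel-verified Lean document; each statement's English description precedes it below -/
import Mathlib

section
/- Let G be a finite group and let z ∈ G. Then the order |G| divides the number of ordered pairs (g,h) ∈ G × G such that the commutator g⁻¹h⁻¹gh is conjugate in G to z. -/
open scoped Pointwise

/-- A subset closed under left multiplication by a subgroup `H` is a union of right cosets of `H`,
so its cardinality is divisible by that of `H`. -/
theorem Subgroup.card_dvd_card_of_mul_mem {G : Type*} [Group G] (H : Subgroup G) (S : Set G)
    (hS : ∀ c ∈ H, ∀ x ∈ S, c * x ∈ S) : Nat.card H ∣ Nat.card S := by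
  have hpre : S⁻¹ = (QuotientGroup.mk : G → G ⧸ H) ⁻¹' (QuotientGroup.mk '' S⁻¹) := by
    refine Set.Subset.antisymm (Set.subset_preimage_image _ _) ?_
    rintro x ⟨y, hy, hyx⟩
    have h := hS _ (H.inv_mem (QuotientGroup.eq.mp hyx)) _ hy
    simpa using h
  rw [← Set.natCard_inv S, hpre, QuotientGroup.card_preimage_mk]
  exact dvd_mul_right _ _

theorem ConjClasses.card_carrier_mul_card_centralizer {G : Type*} [Group G] [Finite G] (g : G) :
    Nat.card (ConjClasses.mk g).carrier * Nat.card (Subgroup.centralizer {g}) = Nat.card G := by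
  rw [Subgroup.nat_card_centralizer_nat_card_stabilizer, ← ConjAct.orbit_eq_carrier_conjClasses,
    ← Nat.card_prod]
  exact Nat.card_congr (MulAction.orbitProdStabilizerEquivGroup (ConjAct G) g)

/-- The centralizer of `g` acts freely on the elements `h` for which the commutator of `g` and `h`
satisfies a given property. -/
theorem card_centralizer_dvd_card_commutator {G : Type*} [Group G] (P : G → Prop) (g : G) :
    Nat.card (Subgroup.centralizer {g}) ∣ Nat.card {h : G // P (g⁻¹ * h⁻¹ * g * h)} := by
  refine Subgroup.card_dvd_card_of_mul_mem _ {h : G | P (g⁻¹ * h⁻¹ * g * h)} fun c hc x hx ↦ ?_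
  have hcg : c⁻¹ * g * c = g := by
    rw [mul_assoc, ← Subgroup.mem_centralizer_singleton_iff.mp hc, inv_mul_cancel_left]
  have h : g⁻¹ * (c * x)⁻¹ * g * (c * x) = g⁻¹ * x⁻¹ * g * x := by
    calc g⁻¹ * (c * x)⁻¹ * g * (c * x) = g⁻¹ * x⁻¹ * (c⁻¹ * g * c) * x := by group
      _ = _ := by rw [hcg]
  simpa only [Set.mem_ofPred_eq, h] using hx

/-- The number of `h` for which the commutator of `g` and `h` is conjugate to `z` depends only on
the conjugacy class of `g`. -/
theorem IsConj.card_isConj_commutator_eq {G : Type*} [Group G] (z : G) {a b : G}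
    (hab : IsConj a b) :
    Nat.card {h : G // IsConj z (a⁻¹ * h⁻¹ * a * h)} =
      Nat.card {h : G // IsConj z (b⁻¹ * h⁻¹ * b * h)} := by
  obtain ⟨c, rfl⟩ := isConj_iff.mp hab
  refine Nat.card_congr ((MulAut.conj c).toEquiv.subtypeEquiv fun h ↦ ?_)
  have key : IsConj (a⁻¹ * h⁻¹ * a * h)
      ((c * a * c⁻¹)⁻¹ * (c * h * c⁻¹)⁻¹ * (c * a * c⁻¹) * (c * h * c⁻¹)) :=
    isConj_iff.mpr ⟨c, by group⟩
  exact ⟨fun hz ↦ hz.trans key, fun hz ↦ hz.trans key.symm⟩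


/-- For a finite group `G` and `z ∈ G`, `|G|` divides the number of pairs `(g,h)` whose
commutator `g⁻¹h⁻¹gh` is conjugate to `z`. -/
theorem stmt_5 (G : Type*) [Group G] [Fintype G] (z : G) :
    Fintype.card G ∣
      Nat.card {p : G × G // IsConj z (p.1⁻¹ * p.2⁻¹ * p.1 * p.2)} := by
  classical
  let f : G → ℕ := fun g ↦ Nat.card {h : G // IsConj z (g⁻¹ * h⁻¹ * g * h)}
  have hcard : Nat.card {p : G × G // IsConj z (p.1⁻¹ * p.2⁻¹ * p.1 * p.2)} = ∑ g, f g := by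
    rw [← Nat.card_sigma]
    exact Nat.card_congr
      (Equiv.subtypeProdEquivSigmaSubtype fun g h ↦ IsConj z (g⁻¹ * h⁻¹ * g * h))
  rw [hcard, ← Finset.sum_fiberwise Finset.univ ConjClasses.mk f]
  refine Finset.dvd_sum fun c _ ↦ ?_
  obtain ⟨g, rfl⟩ := ConjClasses.exists_rep c
  have hconst : ∀ x ∈ Finset.univ.filter fun x ↦ ConjClasses.mk x = ConjClasses.mk g,
      f x = f g := fun x hx ↦
    (ConjClasses.mk_eq_mk_iff_isConj.mp (Finset.mem_filter.mp hx).2).card_isConj_commutator_eq z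
  have hclass : (Finset.univ.filter fun x ↦ ConjClasses.mk x = ConjClasses.mk g).card =
      Nat.card (ConjClasses.mk g).carrier := by
    rw [← Nat.subtype_card _ fun x ↦ by
      rw [Finset.mem_filter_univ, ← ConjClasses.mem_carrier_iff_mk_eq]]
  rw [Finset.sum_congr rfl hconst, Finset.sum_const, smul_eq_mul, hclass,
    ← Nat.card_eq_fintype_card, ← ConjClasses.card_carrier_mul_card_centralizer g]
  exact mul_dvd_mul_left _ (card_centralizer_dvd_card_commutator _ g)
end

section
/- Let d ≥ 1 and g ≥ 1 be integers and let z be an element of the symmetric group S_d. Then d! divides the number of 2g-tuples (x₁,…,x_g,y₁,…,y_g) of elements of S_d such that the product of commutators ∏_{i=1}^{g} x_i⁻¹ y_i⁻¹ x_i y_i is conjugate in S_d to z. -/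
open MulAction in
theorem MulAction.card_dvd_sum_of_card_stabilizer_dvd {G X : Type*} [Group G] [Finite G]
    [Fintype X] [MulAction G X] (f : X → ℕ) (hf : ∀ (g : G) x, f (g • x) = f x)
    (hdvd : ∀ x, Nat.card (stabilizer G x) ∣ f x) : Nat.card G ∣ ∑ x, f x := by
  classical
  have := Fintype.ofFinite G
  rw [← (selfEquivSigmaOrbitsQuotientStabilizer G X).symm.sum_comp, Fintype.sum_sigma]
  refine Finset.dvd_sum fun ω _ => ?_
  have hconst (q : G ⧸ stabilizer G ω.out) :
      f ((selfEquivSigmaOrbitsQuotientStabilizer G X).symm ⟨ω, q⟩) = f ω.out := by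
    induction q using QuotientGroup.induction_on with
    | H g => exact hf g _
  simp only [hconst, Finset.sum_const, Finset.card_univ, smul_eq_mul]
  rw [Subgroup.card_eq_card_quotient_mul_card_subgroup (stabilizer G ω.out),
    Nat.card_eq_fintype_card (α := G ⧸ _)]
  exact mul_dvd_mul_left _ (hdvd _)

theorem MulAction.card_dvd_card_of_stabilizer_eq_bot {G X : Type*} [Group G] [MulAction G X]
    (h : ∀ x : X, stabilizer G x = ⊥) : Nat.card G ∣ Nat.card X := by
  rw [Nat.card_congr (selfEquivOrbitsQuotientProd h), Nat.card_prod]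
  exact dvd_mul_left _ _

section CommutatorProduct

variable {G : Type*} [Group G] {n : ℕ}

/-- The ordered product of the commutators `xᵢ⁻¹yᵢ⁻¹xᵢyᵢ`. -/
def commutatorProd (p : (Fin n → G) × (Fin n → G)) : G :=
  (List.ofFn fun i => (p.1 i)⁻¹ * (p.2 i)⁻¹ * p.1 i * p.2 i).prod

theorem commutatorProd_smul (c : ConjAct G) (p : (Fin n → G) × (Fin n → G)) :
    commutatorProd (c • p) = c • commutatorProd p := by
  simp only [commutatorProd, ← MulDistribMulAction.toMonoidHom_apply, map_list_prod,
    List.map_ofFn]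
  congr 2
  funext i
  simp [smul_mul', smul_inv']

theorem commutatorProd_mulSingle_mul (p : (Fin (n + 1) → G) × (Fin (n + 1) → G)) {c : G}
    (hc : c * p.1 0 = p.1 0 * c) :
    commutatorProd (p.1, Pi.mulSingle 0 c * p.2) = commutatorProd p := by
  simp only [commutatorProd, List.ofFn_succ, List.prod_cons]
  congr 1
  · have hc' : c⁻¹ * (p.1 0 * c) = p.1 0 := by rw [← hc, inv_mul_cancel_left]
    simp only [Pi.mul_apply, Pi.mulSingle_eq_same, mul_inv_rev, mul_assoc]
    rw [← mul_assoc (p.1 0) c, ← mul_assoc c⁻¹, hc']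
  · simp [Pi.mulSingle_eq_of_ne]

theorem smul_eq_self_iff_commute (c : ConjAct G) (x : G) :
    c • x = x ↔ ConjAct.ofConjAct c * x = x * ConjAct.ofConjAct c := by
  rw [ConjAct.smul_def, mul_inv_eq_iff_eq_mul]

/-- The tuples with commutator product conjugate to `z` and first entry `x`. -/
abbrev CommutatorFiber (n : ℕ) (z x : G) :=
  {p : {p : (Fin (n + 1) → G) × (Fin (n + 1) → G) // IsConj z (commutatorProd p)} //
    p.1.1 0 = x}

/-- The centralizer of `x` acts on the fiber over `x` by left multiplication on `y₀`. -/
instance (z x : G) :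
    MulAction (MulAction.stabilizer (ConjAct G) x) (CommutatorFiber n z x) where
  smul c p := ⟨⟨(p.1.1.1, Pi.mulSingle 0 (ConjAct.ofConjAct c.1) * p.1.1.2), by
    rw [commutatorProd_mulSingle_mul]
    · exact p.1.2
    · rw [p.2, ← smul_eq_self_iff_commute]
      exact c.2⟩, p.2⟩
  one_smul p := by
    refine Subtype.ext (Subtype.ext (Prod.ext rfl ?_))
    change Pi.mulSingle 0 (1 : G) * p.1.1.2 = _
    simp
  mul_smul c d p := by
    refine Subtype.ext (Subtype.ext (Prod.ext rfl ?_))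
    change Pi.mulSingle 0 (ConjAct.ofConjAct c.1 * ConjAct.ofConjAct d.1) * p.1.1.2 =
      Pi.mulSingle 0 (ConjAct.ofConjAct c.1) * (Pi.mulSingle 0 (ConjAct.ofConjAct d.1) * p.1.1.2)
    rw [Pi.mulSingle_mul, mul_assoc]

theorem card_stabilizer_dvd_card_commutatorFiber (z x : G) :
    Nat.card (MulAction.stabilizer (ConjAct G) x) ∣ Nat.card (CommutatorFiber n z x) := by
  refine MulAction.card_dvd_card_of_stabilizer_eq_bot fun p => (Subgroup.eq_bot_iff_forall _).2 ?_
  intro c hc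
  have h : Pi.mulSingle 0 (ConjAct.ofConjAct c.1) * p.1.1.2 = p.1.1.2 :=
    congrArg (fun q : CommutatorFiber n z x => q.1.1.2) hc
  rw [mul_eq_right, Pi.mulSingle_eq_one_iff] at h
  exact Subtype.ext h

theorem card_commutatorFiber_smul (z x : G) (c : ConjAct G) :
    Nat.card (CommutatorFiber n z (c • x)) = Nat.card (CommutatorFiber n z x) := by
  refine (Nat.card_congr (((MulAction.toPerm c).subtypeEquiv fun p => ?_).subtypeEquiv
    fun p => ?_)).symm
  · have h : IsConj (commutatorProd p) (c • commutatorProd p) :=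
      isConj_comm.1 (ConjAct.mem_orbit_conjAct.1 ⟨c, rfl⟩)
    rw [MulAction.toPerm_apply, commutatorProd_smul]
    exact ⟨fun hz => hz.trans h, fun hz => hz.trans h.symm⟩
  · exact (smul_left_cancel_iff c).symm

theorem card_dvd_card_isConj_commutatorProd [Finite G] (z : G) :
    Nat.card G ∣ Nat.card {p : (Fin (n + 1) → G) × (Fin (n + 1) → G) //
      IsConj z (commutatorProd p)} := by
  have := Fintype.ofFinite G
  rw [← Nat.card_congr (Equiv.sigmaFiberEquiv fun p : {p : (Fin (n + 1) → G) × (Fin (n + 1) → G) //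
    IsConj z (commutatorProd p)} => p.1.1 0), Nat.card_sigma]
  exact MulAction.card_dvd_sum_of_card_stabilizer_dvd (G := ConjAct G) _
    (fun c x => card_commutatorFiber_smul z x c) (card_stabilizer_dvd_card_commutatorFiber z)

end CommutatorProduct


/-- `d!` divides the number of `2g`-tuples in `S_d` whose ordered product of commutators
`∏ᵢ xᵢ⁻¹yᵢ⁻¹xᵢyᵢ` is conjugate to a fixed `z ∈ S_d`. -/
theorem stmt_8 (d g : ℕ) (hd : 1 ≤ d) (hg : 1 ≤ g) (z : Equiv.Perm (Fin d)) :
    d.factorial ∣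
      Nat.card {p : (Fin g → Equiv.Perm (Fin d)) × (Fin g → Equiv.Perm (Fin d)) //
        IsConj z ((List.ofFn fun i => (p.1 i)⁻¹ * (p.2 i)⁻¹ * p.1 i * p.2 i).prod)} := by
  obtain ⟨n, rfl⟩ := Nat.exists_eq_add_of_le' hg
  have h := card_dvd_card_isConj_commutatorProd (n := n) z
  rwa [Nat.card_perm, Nat.card_fin] at h
end

section
/- Let d ≥ 1 and g ≥ 1 be integers. Then d! divides A_{d,g}, the number of 2g-tuples (x₁,…,x_g,y₁,…,y_g) of elements of the symmetric group S_d satisfying ∏_{i=1}^{g} x_i⁻¹ y_i⁻¹ x_i y_i = 1. In particular a_{d,g} := A_{d,g}/d! is an integer. -/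
/-- `A_{d,g}`: the number of `2g`-tuples `(x₁,…,x_g,y₁,…,y_g)` of elements of `S_d` with
`∏ᵢ xᵢ⁻¹yᵢ⁻¹xᵢyᵢ = 1`. -/
noncomputable def A (d g : ℕ) : ℕ :=
  Nat.card {p : (Fin g → Equiv.Perm (Fin d)) × (Fin g → Equiv.Perm (Fin d)) //
    (List.ofFn fun i => (p.1 i)⁻¹ * (p.2 i)⁻¹ * p.1 i * p.2 i).prod = 1}

/-- If `R` is an invariant relation on a `G`-set `X`, then the order of `G` divides the number of
pairs `(h, v)` in `G × X` with `R v (h⁻¹ • v)`. The pairs inducing a given sequence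
`n ↦ h ^ n • v` form a torsor under the stabilizer of that sequence, so the claim follows from
the orbit-counting bijection. -/
theorem card_dvd_card_pairs_of_invariant {G X : Type*} [Group G] [MulAction G X]
    (R : X → X → Prop) (hR : ∀ (k : G) (v u : X), R v u → R (k • v) (k • u)) :
    Nat.card G ∣ Nat.card {p : G × X // R p.2 (p.1⁻¹ • p.2)} := by
  let S := {p : G × X // R p.2 (p.1⁻¹ • p.2)}
  let f : S → (ℤ → X) := fun p n => p.1.1 ^ n • p.1.2
  let Y : SubMulAction G (ℤ → X) :=
    { carrier := Set.range f
      smul_mem' := by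
        rintro k _ ⟨⟨⟨h, v⟩, hp⟩, rfl⟩
        refine ⟨⟨(k * h * k⁻¹, k • v), ?_⟩, ?_⟩
        · have := hR k _ _ hp
          simpa [mul_smul] using this
        · funext n
          simp [f, conj_zpow, mul_smul] }
  have fiberEquiv : ∀ y : Y, Nonempty ({p : S // f p = y} ≃ {a : G // a • y = y}) := by
    rintro ⟨_, ⟨⟨⟨h, v⟩, hp⟩, rfl⟩⟩
    have key : ∀ z : G, (∀ n : ℤ, z • h ^ n • v = h ^ n • v) →
        ∀ n : ℤ, (z * h) ^ n • v = h ^ n • v := by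
      intro z hz n
      induction n using Int.induction_on with
      | zero => simp
      | succ n ih =>
        rw [add_comm, zpow_add, zpow_one, mul_smul, ih, mul_smul, ← mul_smul h, ← zpow_one_add, hz]
      | pred n ih =>
        rw [sub_eq_neg_add, zpow_add, zpow_neg_one, mul_smul, ih, mul_inv_rev, mul_smul,
          inv_smul_eq_iff.2 (hz _).symm, zpow_add, zpow_neg_one, mul_smul]
    refine ⟨{
      toFun := fun p => ⟨p.1.1.1 * h⁻¹, ?_⟩
      invFun := fun z => ⟨⟨(z.1 * h, v), ?_⟩, ?_⟩
      left_inv := ?_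
      right_inv := ?_ }⟩
    · obtain ⟨⟨⟨h', v'⟩, hp'⟩, e⟩ := p
      have e' : ∀ n : ℤ, h' ^ n • v' = h ^ n • v := fun n => congrFun e n
      refine Subtype.ext (funext fun n => ?_)
      change (h' * h⁻¹) • h ^ n • v = h ^ n • v
      rw [mul_smul, ← mul_smul h⁻¹, ← zpow_neg_one, ← zpow_add, ← e', ← mul_smul, ← zpow_one_add,
        ← e']
      congr 2
      ring
    · have hz : ∀ n : ℤ, z.1 • h ^ n • v = h ^ n • v :=
        fun n => congrFun (congrArg Subtype.val z.2) n
      have := key z.1 hz (-1)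
      rw [zpow_neg_one, zpow_neg_one] at this
      simpa only [this] using hp
    · exact funext (key z.1 fun n => congrFun (congrArg Subtype.val z.2) n)
    · rintro ⟨⟨⟨h', v'⟩, hp'⟩, e⟩
      have : v' = v := by simpa [f] using congrFun e 0
      simp [this]
    · rintro ⟨z, hz⟩
      simp
  let e : S ≃ Quotient (MulAction.orbitRel G Y) × G :=
    calc
      S ≃ Σ y : Y, {p : S // f p = y} :=
        { toFun := fun p => ⟨⟨f p, p, rfl⟩, p, rfl⟩
          invFun := fun q => q.2.1
          left_inv := fun _ => rfl
          right_inv := by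
            rintro ⟨⟨y, hy⟩, p, hp⟩
            obtain rfl : f p = y := hp
            rfl }
      _ ≃ Σ y : Y, {a : G // a • y = y} := Equiv.sigmaCongrRight fun y => (fiberEquiv y).some
      _ ≃ Σ a : G, MulAction.fixedBy Y a :=
        { toFun := fun q => ⟨q.2.1, q.1, q.2.2⟩
          invFun := fun q => ⟨q.2.1, q.1, q.2.2⟩
          left_inv := fun _ => rfl
          right_inv := fun _ => rfl }
      _ ≃ _ := MulAction.sigmaFixedByEquivOrbitsProdGroup G Y
  exact ⟨_, ((Nat.card_congr e).trans (Nat.card_prod _ _)).trans (mul_comm _ _)⟩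

/-- The order of a group divides the number of solutions of the surface relation of positive
genus. -/
theorem card_dvd_card_surface_relation (G : Type*) [Group G] (n : ℕ) :
    Nat.card G ∣ Nat.card {p : (Fin (n + 1) → G) × (Fin (n + 1) → G) //
      (List.ofFn fun i => (p.1 i)⁻¹ * (p.2 i)⁻¹ * p.1 i * p.2 i).prod = 1} := by
  let w : (Fin n → G) × (Fin (n + 1) → G) → (Fin n → G) × (Fin (n + 1) → G) → G := fun v u => (u.2 0)⁻¹ * v.2 0 *
    (List.ofFn fun i : Fin n =>
      (v.1 i)⁻¹ * (v.2 i.succ)⁻¹ * v.1 i * v.2 i.succ).prod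
  have hw : ∀ (k : ConjAct G) (v u : (Fin n → G) × (Fin (n + 1) → G)),
      w (k • v) (k • u) = k • w v u := by
    intro k v u
    simp [w, smul_mul', smul_inv', List.smul_prod', List.map_ofFn, Function.comp_def]
  have hdvd := card_dvd_card_pairs_of_invariant (G := ConjAct G) (fun v u => w v u = 1)
    (fun k v u h => by rw [hw, h, smul_one])
  let e : ConjAct G × (Fin n → G) × (Fin (n + 1) → G) ≃
      (Fin (n + 1) → G) × (Fin (n + 1) → G) :=
    (Equiv.prodAssoc _ _ _).symm.trans
      (((ConjAct.ofConjAct.toEquiv.prodCongr (Equiv.refl _)).trans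
        (Fin.consEquiv fun _ => G)).prodCongr (Equiv.refl _))
  have hcard := Nat.card_congr (e.subtypeEquiv (p := fun p => w p.2 (p.1⁻¹ • p.2) = 1)
    (q := fun p => (List.ofFn fun i => (p.1 i)⁻¹ * (p.2 i)⁻¹ * p.1 i * p.2 i).prod = 1) (by
      rintro ⟨h, x, y⟩
      simp [e, w, Fin.consEquiv, List.ofFn_succ, ConjAct.smul_def, mul_assoc]))
  rw [← hcard]
  exact hdvd

theorem stmt_9 (d g : ℕ) (hd : 1 ≤ d) (hg : 1 ≤ g) :
    d.factorial ∣ A d g ∧ ∃ m : ℤ, (A d g : ℚ) / (d.factorial : ℚ) = (m : ℚ) := by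
  have hdvd : d.factorial ∣ A d g := by
    obtain ⟨n, rfl⟩ := Nat.exists_eq_add_of_le' hg
    have := card_dvd_card_surface_relation (Equiv.Perm (Fin d)) n
    rwa [Nat.card_perm, Nat.card_fin] at this
  refine ⟨hdvd, (A d g / d.factorial : ℕ), ?_⟩
  rw [Int.cast_natCast, Nat.cast_div hdvd (by exact_mod_cast d.factorial_ne_zero)]
end
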